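/- arXiv:1007.2520 — 2 statements merged into one kernel-verified Lean document; each statement's English description precedes it below -/
import Mathlib

section
/- Every continuous map g : SO(4) → ℝ³ satisfying g(−τ) = −g(τ) for all τ ∈ SO(4) has a zero; that is, there exists τ ∈ SO(4) with g(τ) = 0. -/
open scoped Quaternion

/-- A lifting principle on the closed unit ball: if lifts can be transported between uniformly close
maps with values in `M`, and the constant map at `f 0` lifts, then `f` lifts. -/
theorem exists_lift_on_closedBall {E X Y : Type*} [NormedAddCommGroup E] [NormedSpace ℝ E]
    [ProperSpace E] [PseudoMetricSpace X] [TopologicalSpace Y] {M : Set X} {p : Y → X → Prop}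
    {ε : ℝ} (hε : 0 < ε)
    (transport : ∀ (a b : E → X) (F : E → Y), Continuous a → Continuous b →
      (∀ v, a v ∈ M) → (∀ v, b v ∈ M) →
      (∀ v ∈ Metric.closedBall (0 : E) 1, dist (b v) (a v) < ε) →
      ContinuousOn F (Metric.closedBall 0 1) →
      (∀ v ∈ Metric.closedBall (0 : E) 1, p (F v) (a v)) →
      ∃ G : E → Y, ContinuousOn G (Metric.closedBall 0 1) ∧
        ∀ v ∈ Metric.closedBall (0 : E) 1, p (G v) (b v))
    {f : E → X} (hf : Continuous f) (hfM : ∀ v, f v ∈ M) {y : Y} (hy : p y (f 0)) :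
    ∃ F : E → Y, ContinuousOn F (Metric.closedBall 0 1) ∧
      ∀ v ∈ Metric.closedBall (0 : E) 1, p (F v) (f v) := by
  have huc : UniformContinuousOn f (Metric.closedBall 0 1) :=
    (isCompact_closedBall (0 : E) 1).uniformContinuousOn_of_continuous hf.continuousOn
  obtain ⟨δ, hδ, hclose⟩ := Metric.uniformContinuousOn_iff.1 huc ε hε
  obtain ⟨N, hN⟩ := exists_nat_one_div_lt hδ
  have hN0 : (0 : ℝ) < N + 1 := by positivity
  have scaled_mem : ∀ k : ℕ, k ≤ N + 1 → ∀ v ∈ Metric.closedBall (0 : E) 1,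
      ((k : ℝ) / (N + 1)) • v ∈ Metric.closedBall (0 : E) 1 := by
    intro k hk v hv
    rw [mem_closedBall_zero_iff] at hv ⊢
    have hk' : (k : ℝ) ≤ N + 1 := by exact_mod_cast hk
    rw [norm_smul, Real.norm_of_nonneg (by positivity)]
    exact mul_le_one₀ ((div_le_one hN0).2 hk') (norm_nonneg v) hv
  have lift_scaled : ∀ k : ℕ, k ≤ N + 1 → ∃ F : E → Y, ContinuousOn F (Metric.closedBall 0 1) ∧
      ∀ v ∈ Metric.closedBall (0 : E) 1, p (F v) (f (((k : ℝ) / (N + 1)) • v)) := by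
    intro k
    induction k with
    | zero => exact fun _ ↦ ⟨fun _ ↦ y, continuousOn_const, fun v _ ↦ by simpa using hy⟩
    | succ k ih =>
      intro hk
      obtain ⟨F, hF, hFp⟩ := ih (by omega)
      refine transport (fun v ↦ f (((k : ℝ) / (N + 1)) • v)) _ F (by fun_prop) (by fun_prop)
        (fun v ↦ hfM _) (fun v ↦ hfM _) (fun v hv ↦ ?_) hF hFp
      refine hclose _ (scaled_mem _ hk v hv) _ (scaled_mem k (by omega) v hv) ?_
      rw [mem_closedBall_zero_iff] at hv
      rw [dist_eq_norm, ← sub_smul, norm_smul]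
      have hdiff : ((k + 1 : ℕ) : ℝ) / (N + 1) - (k : ℝ) / (N + 1) = 1 / (N + 1) := by
        push_cast; ring
      rw [hdiff, Real.norm_of_nonneg (by positivity)]
      exact (mul_le_of_le_one_right (by positivity) hv).trans_lt hN
  obtain ⟨F, hF, hFp⟩ := lift_scaled (N + 1) le_rfl
  refine ⟨F, hF, fun v hv ↦ ?_⟩
  have hone : ((N + 1 : ℕ) : ℝ) / (N + 1) = 1 := by push_cast; exact div_self hN0.ne'
  simpa only [hone, one_smul] using hFp v hv

/-- A continuous circle-valued map has a continuous logarithm on the closed unit ball. -/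
theorem exists_continuousOn_exp_eq {E : Type*} [NormedAddCommGroup E] [NormedSpace ℝ E]
    [ProperSpace E] {u : E → ℂ} (hu : Continuous u) (hu1 : ∀ v, ‖u v‖ = 1) :
    ∃ φ : E → ℂ, ContinuousOn φ (Metric.closedBall 0 1) ∧
      ∀ v ∈ Metric.closedBall (0 : E) 1, Complex.exp (φ v) = u v := by
  refine exists_lift_on_closedBall (M := Metric.sphere 0 1) (p := fun y x ↦ Complex.exp y = x)
    one_pos ?_ hu (by simpa using hu1) (Complex.exp_log (x := u 0) ?_)
  · intro a b F ha hb ha1 hb1 hab hF hFa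
    simp only [mem_sphere_zero_iff_norm] at ha1 hb1
    have ha0 : ∀ v, a v ≠ 0 := fun v h ↦ by simpa [h] using ha1 v
    have hb0 : ∀ v, b v ≠ 0 := fun v h ↦ by simpa [h] using hb1 v
    refine ⟨fun v ↦ F v + Complex.log (b v / a v),
      hF.add ((hb.div ha ha0).continuousOn.clog fun v hv ↦ ?_), fun v hv ↦ ?_⟩
    · have hlt : ‖b v / a v - 1‖ < 1 := by
        rw [div_sub_one (ha0 v), norm_div, ha1, div_one, ← dist_eq_norm]
        exact hab v hv
      simpa using Complex.mem_slitPlane_of_norm_lt_one hlt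
    · rw [Complex.exp_add, hFa v hv, Complex.exp_log (div_ne_zero (hb0 v) (ha0 v)),
        mul_div_cancel₀ _ (ha0 v)]
  · exact fun h ↦ by simpa [h] using hu1 0

/-- A continuous complex-valued map on the plane that is odd on the unit circle has a zero. -/
theorem exists_zero_of_odd_on_circle {u : ℂ → ℂ} (hu : Continuous u)
    (hodd : ∀ w, ‖w‖ = 1 → u (-w) = -u w) : ∃ w, u w = 0 := by
  by_contra! hne
  obtain ⟨φ, hφ, hexp⟩ := exists_continuousOn_exp_eq (u := fun w ↦ u w / ‖u w‖)
    (hu.div (by fun_prop) fun w ↦ by simpa using hne w) fun w ↦ by simp [hne w]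
  have he : ∀ t : ℝ, ‖Complex.exp (t * Complex.I)‖ = 1 := Complex.norm_exp_ofReal_mul_I
  set d : ℝ → ℂ := fun t ↦ φ (-Complex.exp (t * Complex.I)) - φ (Complex.exp (t * Complex.I))
  have hd : Continuous d := by
    refine (hφ.comp_continuous (by fun_prop) fun t ↦ ?_).sub
      (hφ.comp_continuous (by fun_prop) fun t ↦ ?_) <;> simp [he]
  have hdexp : ∀ t, Complex.exp (d t) = -1 := by
    intro t
    have hw := he t
    simp only [d, Complex.exp_sub]
    generalize Complex.exp (t * Complex.I) = w at hw ⊢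
    have hnorm : (‖u w‖ : ℂ) ≠ 0 := by simpa using hne w
    rw [hexp _ (by simp [hw]), hexp _ (by simp [hw]), hodd w hw, norm_neg]
    have hw0 := hne w
    field_simp
  have hdpi : d Real.pi = -d 0 := by simp [d]
  obtain ⟨t, ht⟩ : ∃ t, (d t).im = 0 := by
    have hc : Continuous fun t ↦ (d t).im := Complex.continuous_im.comp hd
    refine mem_range_of_exists_le_of_exists_ge hc ?_ ?_
    · rcases le_total (d 0).im 0 with h | h
      · exact ⟨0, h⟩
      · exact ⟨Real.pi, by simpa [hdpi] using h⟩
    · rcases le_total (d 0).im 0 with h | h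
      · exact ⟨Real.pi, by simpa [hdpi] using h⟩
      · exact ⟨0, h⟩
  have hre := congrArg Complex.re (hdexp t)
  rw [Complex.exp_re, ht, Real.cos_zero, mul_one] at hre
  have := Real.exp_pos (d t).re
  norm_num at hre
  linarith

/-- The map `v ↦ (max (1 - ‖v‖) 0, v)`, which never vanishes and is odd on the unit
sphere. -/
def dome {E : Type*} [NormedAddCommGroup E] (v : E) : ℝ × E := (max (1 - ‖v‖) 0, v)

theorem continuous_dome {E : Type*} [NormedAddCommGroup E] : Continuous (dome : E → ℝ × E) := by
  unfold dome; fun_prop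

theorem dome_ne_zero {E : Type*} [NormedAddCommGroup E] (v : E) : dome v ≠ 0 := by
  intro h
  obtain ⟨h1, rfl⟩ := Prod.mk_eq_zero.1 h
  simp at h1

theorem dome_neg {E : Type*} [NormedAddCommGroup E] {v : E} (hv : ‖v‖ = 1) :
    dome (-v) = -dome v := by
  simp [dome, hv]

/-- A continuous odd complex-valued map on the unit sphere of `ℝ × ℂ` has a zero. -/
theorem exists_zero_of_odd_on_sphere {u : ℝ × ℂ → ℂ}
    (hu : ContinuousOn u (Metric.sphere 0 1)) (hodd : ∀ v, ‖v‖ = 1 → u (-v) = -u v) :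
    ∃ v, ‖v‖ = 1 ∧ u v = 0 := by
  have hn : ∀ w : ℂ, ‖‖dome w‖⁻¹ • dome w‖ = 1 := fun w ↦ by
    simpa using norm_smul_inv_norm (𝕜 := ℝ) (dome_ne_zero w)
  have hcont : Continuous fun w : ℂ ↦ ‖dome w‖⁻¹ • dome w :=
    (continuous_dome.norm.inv₀ fun w ↦ norm_ne_zero_iff.2 (dome_ne_zero w)).smul continuous_dome
  obtain ⟨w, hw⟩ := exists_zero_of_odd_on_circle
    (u := fun w ↦ u (‖dome w‖⁻¹ • dome w))
    (hu.comp_continuous hcont fun w ↦ by simpa using hn w)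
    (fun w hw ↦ by rw [dome_neg hw, norm_neg, smul_neg, hodd _ (hn w)])
  exact ⟨_, hn w, hw⟩

namespace Quaternion

/-- The quaternion unit `i`. -/
def unitI : ℍ[ℝ] := ⟨0, 1, 0, 0⟩

/-- The quaternion unit `j`. -/
def unitJ : ℍ[ℝ] := ⟨0, 0, 1, 0⟩

/-- The quaternion unit `k`. -/
def unitK : ℍ[ℝ] := ⟨0, 0, 0, 1⟩

@[simp] theorem re_unitI : unitI.re = 0 := rfl
@[simp] theorem imI_unitI : unitI.imI = 1 := rfl
@[simp] theorem imJ_unitI : unitI.imJ = 0 := rfl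
@[simp] theorem imK_unitI : unitI.imK = 0 := rfl
@[simp] theorem re_unitJ : unitJ.re = 0 := rfl
@[simp] theorem imI_unitJ : unitJ.imI = 0 := rfl
@[simp] theorem imJ_unitJ : unitJ.imJ = 1 := rfl
@[simp] theorem imK_unitJ : unitJ.imK = 0 := rfl
@[simp] theorem re_unitK : unitK.re = 0 := rfl
@[simp] theorem imI_unitK : unitK.imI = 0 := rfl
@[simp] theorem imJ_unitK : unitK.imJ = 0 := rfl
@[simp] theorem imK_unitK : unitK.imK = 1 := rfl

theorem norm_eq_one_of_mul_self {a : ℍ[ℝ]} (ha : a * a = -1) : ‖a‖ = 1 := by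
  have h := congrArg norm ha
  rw [norm_mul, norm_neg, norm_one] at h
  nlinarith [norm_nonneg a]

end Quaternion

/-- Over the closed unit ball, a continuous family of square roots of `-1` in the quaternions is
continuously conjugate to the constant family `i`. -/
theorem exists_continuousOn_conjugator {E : Type*} [NormedAddCommGroup E] [NormedSpace ℝ E]
    [ProperSpace E] {f : E → ℍ[ℝ]} (hf : Continuous f) (hf1 : ∀ v, f v * f v = -1) :
    ∃ F : E → ℍ[ℝ], ContinuousOn F (Metric.closedBall 0 1) ∧
      ∀ v ∈ Metric.closedBall (0 : E) 1,
        ‖F v‖ = 1 ∧ f v * F v = F v * Quaternion.unitI := by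
  obtain ⟨q, hq0, hq⟩ : ∃ q : ℍ[ℝ], q ≠ 0 ∧ f 0 * q = q * Quaternion.unitI := by
    have hi : Quaternion.unitI * Quaternion.unitI = -1 := by ext <;> simp
    by_cases h : 1 - f 0 * Quaternion.unitI = 0
    · have hf0 : f 0 = -Quaternion.unitI := by
        calc f 0 = -(f 0 * (Quaternion.unitI * Quaternion.unitI)) := by simp [hi]
          _ = _ := by rw [← mul_assoc, ← sub_eq_zero.1 h, one_mul]
      refine ⟨Quaternion.unitJ, fun h ↦ by simpa using (Quaternion.ext_iff.1 h).2.2.1, ?_⟩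
      rw [hf0]
      ext <;> simp
    · refine ⟨_, h, ?_⟩
      rw [mul_sub, sub_mul, ← mul_assoc, hf1, mul_assoc (f 0), hi]
      simp [add_comm]
  obtain ⟨F, hF, hFp⟩ : ∃ F : E → ℍ[ℝ], ContinuousOn F (Metric.closedBall 0 1) ∧
      ∀ v ∈ Metric.closedBall (0 : E) 1, F v ≠ 0 ∧ f v * F v = F v * Quaternion.unitI := by
    refine exists_lift_on_closedBall (M := {a : ℍ[ℝ] | a * a = -1})
      (p := fun (y x : ℍ[ℝ]) ↦ y ≠ 0 ∧ x * y = y * Quaternion.unitI) one_pos ?_ hf hf1 ⟨hq0, hq⟩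
    intro a b F ha hb ha1 hb1 hab hF hFa
    simp only [Set.mem_ofPred_eq] at ha1 hb1
    refine ⟨fun v ↦ (1 - b v * a v) * F v, ContinuousOn.mul (by fun_prop) hF, fun v hv ↦
      ⟨mul_ne_zero (fun h ↦ ?_) (hFa v hv).1, ?_⟩⟩
    · have hba : b v = -a v := by
        calc b v = -(b v * (a v * a v)) := by simp [ha1]
          _ = _ := by rw [← mul_assoc, ← sub_eq_zero.1 h, one_mul]
      have hlt := hab v hv
      rw [dist_eq_norm, hba, ← neg_add', norm_neg, ← two_smul ℝ, norm_smul,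
        Quaternion.norm_eq_one_of_mul_self (ha1 v)] at hlt
      norm_num at hlt
    · have hcomm : b v * (1 - b v * a v) = (1 - b v * a v) * a v := by
        rw [mul_sub, sub_mul, ← mul_assoc, hb1, mul_assoc (b v), ha1]
        simp [add_comm]
      rw [← mul_assoc, hcomm, mul_assoc, (hFa v hv).2, mul_assoc]
  refine ⟨fun v ↦ ‖F v‖⁻¹ • F v,
    (hF.norm.inv₀ fun v hv ↦ norm_ne_zero_iff.2 (hFp v hv).1).smul hF, fun v hv ↦ ⟨?_, ?_⟩⟩
  · simpa using norm_smul_inv_norm (𝕜 := ℝ) (hFp v hv).1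
  · rw [mul_smul_comm, (hFp v hv).2, smul_mul_assoc]

/-- A continuous family of square roots of `-1` in the quaternions over `ℝ × ℂ` is not odd on the
unit sphere. -/
theorem not_odd_on_sphere_of_mul_self_eq_neg_one {f : ℝ × ℂ → ℍ[ℝ]} (hf : Continuous f)
    (hf1 : ∀ v, f v * f v = -1) : ¬ ∀ v, ‖v‖ = 1 → f (-v) = -f v := by
  intro hodd
  obtain ⟨F, hF, hFp⟩ := exists_continuousOn_conjugator hf hf1
  have hmem : ∀ {v : ℝ × ℂ}, ‖v‖ = 1 → v ∈ Metric.closedBall (0 : ℝ × ℂ) 1 := fun hv ↦ by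
    simp [hv]
  set c : ℝ × ℂ → ℍ[ℝ] := fun v ↦ (F v)⁻¹ * (F (-v) * Quaternion.unitJ) with hc
  have hFne : ∀ v, ‖v‖ = 1 → F v ≠ 0 := fun v hv h ↦ by simpa [h] using (hFp v (hmem hv)).1
  have hFc : ∀ v, ‖v‖ = 1 → F v * c v = F (-v) * Quaternion.unitJ := fun v hv ↦
    mul_inv_cancel_left₀ (hFne v hv) _
  have hcont : ContinuousOn c (Metric.sphere 0 1) := by
    have hF' : ContinuousOn F (Metric.sphere 0 1) := hF.mono Metric.sphere_subset_closedBall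
    refine (hF'.inv₀ fun v hv ↦ hFne v (by simpa using hv)).mul
      ((hF'.comp continuous_neg.continuousOn fun v hv ↦ ?_).mul continuousOn_const)
    simpa using hv
  have hci : ∀ v, ‖v‖ = 1 → c v * Quaternion.unitI = Quaternion.unitI * c v := by
    intro v hv
    have hij : Quaternion.unitJ * Quaternion.unitI = -(Quaternion.unitI * Quaternion.unitJ) := by
      ext <;> simp
    refine mul_left_cancel₀ (hFne v hv) ?_
    have hneg := (hFp (-v) (hmem (by simpa using hv))).2
    rw [hodd v hv, neg_mul] at hneg
    calc F v * (c v * Quaternion.unitI)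
        = -(F (-v) * Quaternion.unitI * Quaternion.unitJ) := by
          rw [← mul_assoc, hFc v hv, mul_assoc, hij, mul_neg, mul_assoc]
      _ = f v * (F v * c v) := by rw [← hneg, hFc v hv, neg_mul, neg_neg, mul_assoc]
      _ = F v * (Quaternion.unitI * c v) := by
          rw [← mul_assoc, (hFp v (hmem hv)).2, mul_assoc]
  have hcJ : ∀ v, ‖v‖ = 1 → (c v).imJ = 0 := fun v hv ↦ by
    have := (Quaternion.ext_iff.1 (hci v hv)).2.2.2
    simp at this
    linarith
  have hcK : ∀ v, ‖v‖ = 1 → (c v).imK = 0 := fun v hv ↦ by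
    have := (Quaternion.ext_iff.1 (hci v hv)).2.2.1
    simp at this
    linarith
  have hcsq : ∀ v, ‖v‖ = 1 → (c v).re ^ 2 + (c v).imI ^ 2 = 1 := by
    intro v hv
    have hj : ‖Quaternion.unitJ‖ = 1 :=
      Quaternion.norm_eq_one_of_mul_self (by ext <;> simp)
    have hn : ‖c v‖ = 1 := by
      simp only [hc, norm_mul, norm_inv, hj, (hFp v (hmem hv)).1,
        (hFp (-v) (hmem (by simpa using hv))).1]
      norm_num
    have hsq := Quaternion.normSq_eq_norm_mul_self (c v)
    rw [hn, Quaternion.normSq_def', hcJ v hv, hcK v hv] at hsq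
    linarith
  have hcneg : ∀ v, ‖v‖ = 1 → c v * (Quaternion.unitJ * c (-v)) = -Quaternion.unitJ := by
    intro v hv
    have hjj : Quaternion.unitJ * Quaternion.unitJ = -1 := by ext <;> simp
    have hFc' := hFc (-v) (by simpa using hv)
    rw [neg_neg] at hFc'
    refine mul_left_cancel₀ (hFne v hv) ?_
    rw [← mul_assoc, hFc v hv, mul_assoc, ← mul_assoc Quaternion.unitJ, hjj, neg_one_mul,
      mul_neg, hFc', mul_neg]
  have hucont : ContinuousOn (fun v ↦ ((c v).re : ℂ) + (c v).imI * Complex.I)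
      (Metric.sphere 0 1) := by
    have hre := Quaternion.continuous_re.comp_continuousOn hcont
    have him := Quaternion.continuous_imI.comp_continuousOn hcont
    exact (Complex.continuous_ofReal.comp_continuousOn hre).add
      ((Complex.continuous_ofReal.comp_continuousOn him).mul continuousOn_const)
  have huodd : ∀ v, ‖v‖ = 1 → ((c (-v)).re : ℂ) + (c (-v)).imI * Complex.I =
      -((c v).re + (c v).imI * Complex.I) := by
    intro v hv
    have hv' : ‖-v‖ = 1 := by simpa using hv
    have hJ := (Quaternion.ext_iff.1 (hcneg v hv)).2.2.1
    have hK := (Quaternion.ext_iff.1 (hcneg v hv)).2.2.2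
    simp [hcJ v hv, hcK v hv, hcJ _ hv', hcK _ hv'] at hJ hK
    have hre : (c (-v)).re = -(c v).re := by
      linear_combination (c v).re * hJ + (c v).imI * hK - (c (-v)).re * hcsq v hv
    have him : (c (-v)).imI = -(c v).imI := by
      linear_combination (c v).imI * hJ - (c v).re * hK - (c (-v)).imI * hcsq v hv
    rw [hre, him]
    push_cast
    ring
  obtain ⟨v, hv, hv0⟩ := exists_zero_of_odd_on_sphere hucont huodd
  have hre := congrArg Complex.re hv0
  have him := congrArg Complex.im hv0
  simp at hre him
  simpa [hre, him] using hcsq v hv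

/-- The matrix of left multiplication by the quaternion with the given coordinates. -/
def leftMulMatrix (p : ℝ × ℝ × ℂ) : Matrix (Fin 4) (Fin 4) ℝ :=
  !![p.1, -p.2.1, -p.2.2.re, -p.2.2.im;
    p.2.1, p.1, -p.2.2.im, p.2.2.re;
    p.2.2.re, p.2.2.im, p.1, -p.2.1;
    p.2.2.im, -p.2.2.re, p.2.1, p.1]

/-- The squared Euclidean length of a quaternion given by coordinates. -/
def sqLength (p : ℝ × ℝ × ℂ) : ℝ := p.1 ^ 2 + p.2.1 ^ 2 + p.2.2.re ^ 2 + p.2.2.im ^ 2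

theorem sqLength_pos {p : ℝ × ℝ × ℂ} (hp : p ≠ 0) : 0 < sqLength p := by
  contrapose! hp
  obtain ⟨a, b, z⟩ := p
  simp only [sqLength] at hp
  have ha : a = 0 := by nlinarith [sq_nonneg a, sq_nonneg b, sq_nonneg z.re, sq_nonneg z.im]
  have hb : b = 0 := by nlinarith [sq_nonneg a, sq_nonneg b, sq_nonneg z.re, sq_nonneg z.im]
  have hz : z = 0 := by
    apply Complex.ext <;>
      simp only [Complex.zero_re, Complex.zero_im] <;>
      nlinarith [sq_nonneg a, sq_nonneg b, sq_nonneg z.re, sq_nonneg z.im]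
  simp [ha, hb, hz]

theorem leftMulMatrix_neg (p : ℝ × ℝ × ℂ) : leftMulMatrix (-p) = -leftMulMatrix p := by
  ext i j
  fin_cases i <;> fin_cases j <;> simp [leftMulMatrix]

theorem sqLength_neg (p : ℝ × ℝ × ℂ) : sqLength (-p) = sqLength p := by
  simp [sqLength]

theorem leftMulMatrix_mul_transpose (p : ℝ × ℝ × ℂ) :
    leftMulMatrix p * (leftMulMatrix p).transpose = sqLength p • 1 := by
  ext i j
  fin_cases i <;> fin_cases j <;>
    simp [leftMulMatrix, sqLength, Matrix.mul_apply, Fin.sum_univ_four] <;> ring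

theorem det_leftMulMatrix (p : ℝ × ℝ × ℂ) : (leftMulMatrix p).det = sqLength p ^ 2 := by
  simp [leftMulMatrix, sqLength, Matrix.det_succ_row_zero, Fin.sum_univ_succ, Fin.succAbove]
  ring

theorem continuous_leftMulMatrix : Continuous leftMulMatrix := by
  refine continuous_matrix fun i j ↦ ?_
  fin_cases i <;> fin_cases j <;> simp [leftMulMatrix] <;> fun_prop

theorem continuous_sqLength : Continuous sqLength := by
  unfold sqLength
  fun_prop

theorem normalized_leftMulMatrix_mem {p : ℝ × ℝ × ℂ} (hp : p ≠ 0) :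
    (√(sqLength p))⁻¹ • leftMulMatrix p ∈ Matrix.specialOrthogonalGroup (Fin 4) ℝ := by
  have hs := sqLength_pos hp
  have hsq : √(sqLength p) ^ 2 = sqLength p := Real.sq_sqrt hs.le
  have hne : √(sqLength p) ≠ 0 := (Real.sqrt_pos.2 hs).ne'
  refine Matrix.mem_specialOrthogonalGroup_iff.2 ⟨(Matrix.mem_orthogonalGroup_iff _ _).2 ?_, ?_⟩
  · rw [Matrix.transpose_smul, Matrix.smul_mul, Matrix.mul_smul, leftMulMatrix_mul_transpose,
      smul_smul, smul_smul]
    convert one_smul ℝ (1 : Matrix (Fin 4) (Fin 4) ℝ)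
    field_simp
    exact hsq.symm
  · rw [Matrix.det_smul, det_leftMulMatrix, Fintype.card_fin]
    field_simp
    linear_combination (-(√(sqLength p)) ^ 2 - sqLength p) * hsq

/-- Every continuous odd map `g : SO(4) → ℝ³` has a zero. -/
theorem odd_map_SO4_to_R3_has_zero
    (g : Matrix (Fin 4) (Fin 4) ℝ → EuclideanSpace ℝ (Fin 3))
    (hg : ContinuousOn g (Matrix.specialOrthogonalGroup (Fin 4) ℝ : Set (Matrix (Fin 4) (Fin 4) ℝ)))
    (hodd : ∀ τ ∈ Matrix.specialOrthogonalGroup (Fin 4) ℝ, g (-τ) = -g τ) :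
    ∃ τ ∈ Matrix.specialOrthogonalGroup (Fin 4) ℝ, g τ = 0 := by
  by_contra! hne
  set m : ℝ × ℂ → Matrix (Fin 4) (Fin 4) ℝ :=
    fun v ↦ (√(sqLength (dome v)))⁻¹ • leftMulMatrix (dome v) with hm
  have hmem : ∀ v, m v ∈ Matrix.specialOrthogonalGroup (Fin 4) ℝ := fun v ↦
    normalized_leftMulMatrix_mem (dome_ne_zero v)
  have hmcont : Continuous m :=
    ((continuous_sqLength.comp continuous_dome).sqrt.inv₀ fun v ↦
      (Real.sqrt_pos.2 (sqLength_pos (dome_ne_zero v))).ne').smul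
      (continuous_leftMulMatrix.comp continuous_dome)
  have hmneg : ∀ v, ‖v‖ = 1 → m (-v) = -m v := fun v hv ↦ by
    simp only [hm, dome_neg hv, sqLength_neg, leftMulMatrix_neg, smul_neg]
  set x : ℝ × ℂ → EuclideanSpace ℝ (Fin 3) := fun v ↦ ‖g (m v)‖⁻¹ • g (m v) with hx
  have hgm : Continuous fun v ↦ g (m v) := hg.comp_continuous hmcont hmem
  have hxcont : Continuous x :=
    (hgm.norm.inv₀ fun v ↦ norm_ne_zero_iff.2 (hne _ (hmem v))).smul hgm
  have hxnorm : ∀ v, x v 0 ^ 2 + x v 1 ^ 2 + x v 2 ^ 2 = 1 := fun v ↦ by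
    have hn : ‖x v‖ = 1 := by simpa using norm_smul_inv_norm (𝕜 := ℝ) (hne _ (hmem v))
    have hsq := EuclideanSpace.real_norm_sq_eq (x v)
    rw [hn, Fin.sum_univ_three] at hsq
    linarith
  have hxneg : ∀ v, ‖v‖ = 1 → x (-v) = -x v := fun v hv ↦ by
    simp only [hx, hmneg v hv, hodd _ (hmem v), norm_neg, smul_neg]
  refine not_odd_on_sphere_of_mul_self_eq_neg_one
    (f := fun v ↦ x v 0 • Quaternion.unitI + x v 1 • Quaternion.unitJ + x v 2 • Quaternion.unitK)
    (by fun_prop) (fun v ↦ ?_) fun v hv ↦ ?_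
  · ext <;> simp <;> linarith [hxnorm v]
  · simp only [hxneg v hv, PiLp.neg_apply, neg_smul, neg_add]
end

section
/- Let P ⊂ ℝ⁴ be a centrally symmetric convex polytope with at most 14 facets, circumscribed about the Euclidean ball of diameter 1. Then for every convex body C ⊂ ℝ⁴ of constant width 1, there exist a rotation τ ∈ SO(4) and a translation vector x ∈ ℝ⁴ such that C ⊆ x + τ(P). -/
open scoped RealInnerProductSpace

/-! Chains mod 2 on lists of points, barycentric subdivision, and a proof of the Borsuk–Ulam theorem
for odd maps `ℝ⁴ → ℝ³` by counting alternating simplices in the sense of Ky Fan.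
The covering theorem follows by applying it to the left multiplications by quaternions. -/

noncomputable section

namespace ListChain
open Finsupp

variable {X Y : Type*}

/-- Chains mod 2 whose simplices are lists of vertices; the empty list is the augmentation. -/
abbrev Chain (X : Type*) := List X →₀ ZMod 2

/-- The sum of the codimension-one faces of a simplex. -/
def faces : List X → Chain X
  | [] => 0
  | a :: l => single l 1 + lmapDomain (ZMod 2) (ZMod 2) (List.cons a) (faces l)

/-- The boundary operator of the augmented chain complex. -/
def boundary : Chain X →ₗ[ZMod 2] Chain X := linearCombination (ZMod 2) faces

/-- The cone with apex `a`. -/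
def cone (a : X) : Chain X →ₗ[ZMod 2] Chain X := lmapDomain (ZMod 2) (ZMod 2) (List.cons a)

/-- The chain map induced by a map of vertices. -/
def push (g : X → Y) : Chain X →ₗ[ZMod 2] Chain Y := lmapDomain (ZMod 2) (ZMod 2) (List.map g)

@[simp] lemma boundary_single (l : List X) : boundary (single l 1) = faces l := by
  simp [boundary]

@[simp] lemma cone_single (a : X) (l : List X) : cone a (single l 1) = single (a :: l) 1 := by
  simp [cone]

@[simp] lemma push_single (g : X → Y) (l : List X) :
    push g (single l 1) = single (l.map g) 1 := by
  simp [push]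

@[simp] lemma faces_nil : faces ([] : List X) = 0 := rfl

lemma faces_cons (a : X) (l : List X) : faces (a :: l) = single l 1 + cone a (faces l) := rfl

lemma boundary_cone (a : X) (c : Chain X) : boundary (cone a c) = c + cone a (boundary c) := by
  have : boundary ∘ₗ cone a = LinearMap.id + cone a ∘ₗ boundary := by
    ext l : 2
    simp [faces_cons]
  exact LinearMap.congr_fun this c

lemma chain_add_self (c : Chain X) : c + c = 0 := by
  ext l
  exact CharTwo.add_self_eq_zero _

lemma boundary_faces (l : List X) : boundary (faces l) = 0 := by
  induction l with
  | nil => simp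
  | cons a l ih => rw [faces_cons, map_add, boundary_cone, ih]; simp [chain_add_self]

lemma boundary_boundary (c : Chain X) : boundary (boundary c) = 0 := by
  have : (boundary ∘ₗ boundary : Chain X →ₗ[ZMod 2] Chain X) = 0 := by
    ext l : 2
    simp [boundary_faces]
  exact LinearMap.congr_fun this c

lemma push_cone (g : X → Y) (a : X) (c : Chain X) : push g (cone a c) = cone (g a) (push g c) := by
  have : push g ∘ₗ cone a = cone (g a) ∘ₗ push g := by
    ext l : 2
    simp
  exact LinearMap.congr_fun this c

lemma push_faces (g : X → Y) (l : List X) : push g (faces l) = faces (l.map g) := by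
  induction l with
  | nil => simp
  | cons a l ih => simp [faces_cons, push_cone, ih]

lemma boundary_push (g : X → Y) (c : Chain X) : boundary (push g c) = push g (boundary c) := by
  have : boundary ∘ₗ push g = push g ∘ₗ boundary := by
    ext l : 2
    simp [push_faces]
  exact LinearMap.congr_fun this c

/-- Subdivision of chains of simplices with `n` vertices: a simplex `l` is replaced by the cone with
apex `b l` over its subdivided faces. -/
def subdiv (b : List X → X) : ℕ → Chain X →ₗ[ZMod 2] Chain X
  | 0 => LinearMap.id
  | n + 1 => linearCombination (ZMod 2) fun l => cone (b l) (subdiv b n (faces l))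

lemma subdiv_succ_single (b : List X → X) (n : ℕ) (l : List X) :
    subdiv b (n + 1) (single l 1) = cone (b l) (subdiv b n (faces l)) := by
  simp [subdiv]

lemma boundary_subdiv (b : List X → X) (n : ℕ) (c : Chain X) :
    boundary (subdiv b (n + 1) c) = subdiv b n (boundary c) := by
  induction n generalizing c with
  | zero =>
    have : boundary ∘ₗ subdiv b 1 = subdiv b 0 ∘ₗ boundary := by
      ext l : 2
      simp [boundary_cone, subdiv, boundary_faces]
    exact LinearMap.congr_fun this c
  | succ n ih =>
    have : boundary ∘ₗ subdiv b (n + 2) = subdiv b (n + 1) ∘ₗ boundary := by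
      ext l : 2
      simp [subdiv_succ_single, boundary_cone, ih, boundary_faces]
    exact LinearMap.congr_fun this c

lemma push_subdiv (b : List X → X) (g : X → X) (hg : ∀ l, b (l.map g) = g (b l)) (n : ℕ)
    (c : Chain X) : push g (subdiv b n c) = subdiv b n (push g c) := by
  induction n generalizing c with
  | zero => rfl
  | succ n ih =>
    have : push g ∘ₗ subdiv b (n + 1) = subdiv b (n + 1) ∘ₗ push g := by
      ext l : 2
      simp [subdiv_succ_single, push_cone, ih, push_faces, hg]
    exact LinearMap.congr_fun this c

/-- The chains supported on `s`. -/
abbrev On (s : Set (List X)) : Submodule (ZMod 2) (Chain X) := supported (ZMod 2) (ZMod 2) s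

lemma map_mem_of_single {V : Type*} [AddCommGroup V] [Module (ZMod 2) V]
    {s : Set (List X)} {T : Chain X →ₗ[ZMod 2] V} {W : Submodule (ZMod 2) V}
    (h : ∀ l ∈ s, T (single l 1) ∈ W) {c : Chain X} (hc : c ∈ On s) : T c ∈ W := by
  have : On s ≤ W.comap T := by
    rw [On, supported_eq_span_single, Submodule.span_le]
    rintro _ ⟨l, hl, rfl⟩
    exact h l hl
  exact this hc

lemma eq_of_single {V : Type*} [AddCommGroup V] [Module (ZMod 2) V]
    {s : Set (List X)} {T U : Chain X →ₗ[ZMod 2] V}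
    (h : ∀ l ∈ s, T (single l 1) = U (single l 1)) {c : Chain X} (hc : c ∈ On s) : T c = U c := by
  have := map_mem_of_single (T := T - U) (W := ⊥) (s := s) (by
    intro l hl; simp [h l hl]) hc
  simpa [sub_eq_zero] using this

lemma single_mem_on {s : Set (List X)} {l : List X} (h : l ∈ s) : single l 1 ∈ On s :=
  single_mem_supported _ _ h

lemma cone_mem_on {s t : Set (List X)} {a : X} (h : ∀ l ∈ s, a :: l ∈ t) {c : Chain X}
    (hc : c ∈ On s) : cone a c ∈ On t :=
  map_mem_of_single (fun l hl => by rw [cone_single]; exact single_mem_on (h l hl)) hc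

lemma push_mem_on {g : X → Y} {s : Set (List X)} {t : Set (List Y)} (h : ∀ l ∈ s, l.map g ∈ t)
    {c : Chain X} (hc : c ∈ On s) : push g c ∈ On t :=
  map_mem_of_single (fun l hl => by rw [push_single]; exact single_mem_on (h l hl)) hc

lemma faces_mem_on (l : List X) :
    faces l ∈ On {l' | l'.length + 1 = l.length ∧ ∀ x ∈ l', x ∈ l} := by
  induction l with
  | nil => exact zero_mem _
  | cons a l ih =>
    rw [faces_cons]
    refine add_mem (single_mem_on ⟨by simp, fun x hx => by simp [hx]⟩) (cone_mem_on ?_ ih)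
    rintro l' ⟨h1, h2⟩
    refine ⟨by simp [h1], ?_⟩
    intro x hx
    rcases List.mem_cons.1 hx with rfl | hx
    · simp
    · simp [h2 x hx]

section Metric

variable {E : Type*} [NormedAddCommGroup E] [NormedSpace ℝ E]

/-- The barycenter of a list of points. -/
def bary (l : List E) : E := (l.length : ℝ)⁻¹ • l.sum

lemma bary_map_neg (l : List E) : bary (l.map fun x => -x) = - bary l := by
  have : (l.map fun x => -x).sum = - l.sum := by
    induction l with
    | nil => simp
    | cons a l ih => simp [ih]; abel
  simp [bary, this]

lemma bary_mem_convexHull {l : List E} (hl : l ≠ []) : bary l ∈ convexHull ℝ {x | x ∈ l} := by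
  have hlen : (0 : ℝ) < l.length := by exact_mod_cast List.length_pos_iff.2 hl
  have hsum : l.sum = ∑ i : Fin l.length, l.get i := by simp
  rw [bary, hsum, Finset.smul_sum]
  refine (convex_convexHull ℝ _).sum_mem (fun _ _ => by positivity) ?_ fun i _ => ?_
  · simp [hlen.ne']
  · exact subset_convexHull ℝ _ (List.get_mem l i)

lemma norm_list_sum_sub_le (y : E) {δ : ℝ} (l : List E) (h : ∀ z ∈ l, ‖z - y‖ ≤ δ) :
    ‖l.sum - (l.length : ℝ) • y‖ ≤ l.length * δ := by
  induction l with
  | nil => simp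
  | cons a l ih =>
    have h1 := ih fun z hz => h z (by simp [hz])
    have h2 := h a (by simp)
    have : (a :: l).sum - ((a :: l).length : ℝ) • y = (a - y) + (l.sum - (l.length : ℝ) • y) := by
      simp [add_smul]; abel
    rw [this]
    refine (norm_add_le _ _).trans ?_
    simp only [List.length_cons]
    push_cast
    linarith

lemma norm_bary_sub_le {l : List E} {n : ℕ} (hn : l.length ≤ n) {δ : ℝ} (hδ : 0 ≤ δ) {y : E}
    (hy : y ∈ l) (h : ∀ z ∈ l, ‖z - y‖ ≤ δ) : ‖bary l - y‖ ≤ (1 - (n : ℝ)⁻¹) * δ := by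
  classical
  have hpos : 0 < l.length := List.length_pos_of_mem hy
  have hlen : (0 : ℝ) < l.length := by exact_mod_cast hpos
  have hsum : l.sum = y + (l.erase y).sum := by rw [← List.sum_erase hy]
  have hle : ((l.erase y).length : ℝ) = l.length - 1 := by
    rw [List.length_erase_of_mem hy, Nat.cast_sub hpos]; simp
  have key := norm_list_sum_sub_le y (l.erase y) fun z hz => h z (List.mem_of_mem_erase hz)
  have : bary l - y = (l.length : ℝ)⁻¹ • ((l.erase y).sum - ((l.erase y).length : ℝ) • y) := by
    have hy' : y = (l.length : ℝ)⁻¹ • ((l.length : ℝ) • y) := by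
      rw [smul_smul, inv_mul_cancel₀ hlen.ne', one_smul]
    rw [hle, bary, hsum, sub_smul, one_smul]
    nth_rewrite 3 [hy']
    rw [← smul_sub]
    congr 1
    abel
  rw [this, norm_smul, norm_inv, Real.norm_of_nonneg hlen.le]
  rw [hle] at key ⊢
  calc (l.length : ℝ)⁻¹ * ‖(l.erase y).sum - ((l.length : ℝ) - 1) • y‖
      ≤ (l.length : ℝ)⁻¹ * (((l.length : ℝ) - 1) * δ) := by gcongr
    _ = (1 - (l.length : ℝ)⁻¹) * δ := by field_simp
    _ ≤ _ := by gcongr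

lemma subdiv_single_mem_on {N n : ℕ} (hn : n ≤ N) {δ : ℝ} (hδ : 0 ≤ δ) {l : List E}
    (hl : l.length = n) (h : ∀ x ∈ l, ∀ y ∈ l, dist x y ≤ δ) :
    subdiv bary n (single l 1) ∈ On {l' | l'.length = n ∧ (∀ x ∈ l', x ∈ convexHull ℝ {y | y ∈ l}) ∧
      ∀ x ∈ l', ∀ y ∈ l', dist x y ≤ (1 - (N : ℝ)⁻¹) * δ} := by
  induction n generalizing l with
  | zero =>
    obtain rfl := List.length_eq_zero_iff.1 hl
    exact single_mem_on (by simp)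
  | succ n ih =>
    rw [subdiv_succ_single]
    have hne : l ≠ [] := by rintro rfl; simp at hl
    have hN : 0 ≤ (1 - (N : ℝ)⁻¹) * δ := by
      have : (N : ℝ)⁻¹ ≤ 1 := inv_le_one_of_one_le₀ (by exact_mod_cast (by omega : 1 ≤ N))
      exact mul_nonneg (by linarith) hδ
    have hb : ∀ x ∈ convexHull ℝ {y | y ∈ l}, dist x (bary l) ≤ (1 - (N : ℝ)⁻¹) * δ := by
      have : convexHull ℝ {y | y ∈ l} ⊆ Metric.closedBall (bary l) ((1 - (N : ℝ)⁻¹) * δ) := by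
        refine convexHull_min (fun y hy => ?_) (convex_closedBall _ _)
        rw [Metric.mem_closedBall, dist_comm, dist_eq_norm]
        exact norm_bary_sub_le (hl.trans_le hn) hδ hy fun z hz => by
          rw [← dist_eq_norm]; exact h z hz y hy
      exact fun x hx => this hx
    refine cone_mem_on (s := {l' | l'.length = n ∧ (∀ x ∈ l', x ∈ convexHull ℝ {y | y ∈ l}) ∧
      ∀ x ∈ l', ∀ y ∈ l', dist x y ≤ (1 - (N : ℝ)⁻¹) * δ}) ?_ ?_
    · rintro l' ⟨h1, h2, h3⟩
      refine ⟨by simp [h1], ?_, ?_⟩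
      · intro x hx
        rcases List.mem_cons.1 hx with rfl | hx
        · exact bary_mem_convexHull hne
        · exact h2 x hx
      · intro x hx y hy
        rcases List.mem_cons.1 hx with rfl | hx <;> rcases List.mem_cons.1 hy with rfl | hy
        · simpa using hN
        · rw [dist_comm]; exact hb y (h2 y hy)
        · exact hb x (h2 x hx)
        · exact h3 x hx y hy
    · refine map_mem_of_single (fun l' hl' => ?_) (faces_mem_on l)
      have hsub : {y | y ∈ l'} ⊆ {y | y ∈ l} := hl'.2
      refine supported_mono ?_ (ih (by omega) (l := l') (by have := hl'.1; omega)
        fun x hx y hy => h x (hsub hx) y (hsub hy))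
      rintro l'' ⟨h1, h2, h3⟩
      exact ⟨h1, fun x hx => convexHull_mono hsub (h2 x hx), h3⟩

/-- Lists of length `n` whose entries lie in a common member of `𝒦` and have pairwise distance at
most `δ`. -/
def Fine (𝒦 : Set (Set E)) (n : ℕ) (δ : ℝ) : Set (List E) :=
  {l | l.length = n ∧ (∃ K ∈ 𝒦, ∀ x ∈ l, x ∈ K) ∧ ∀ x ∈ l, ∀ y ∈ l, dist x y ≤ δ}

lemma subdiv_iterate_mem_on {𝒦 : Set (Set E)} (h𝒦 : ∀ K ∈ 𝒦, Convex ℝ K) {N n : ℕ} (hn : n ≤ N)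
    (hN : 1 ≤ N) {δ : ℝ} (hδ : 0 ≤ δ) {c : Chain E} (hc : c ∈ On (Fine 𝒦 n δ)) (k : ℕ) :
    (subdiv bary n)^[k] c ∈ On (Fine 𝒦 n ((1 - (N : ℝ)⁻¹) ^ k * δ)) := by
  have hr : 0 ≤ 1 - (N : ℝ)⁻¹ := by
    have : (N : ℝ)⁻¹ ≤ 1 := inv_le_one_of_one_le₀ (by exact_mod_cast hN)
    linarith
  induction k with
  | zero => simpa using hc
  | succ k ih =>
    rw [Function.iterate_succ_apply']
    refine map_mem_of_single (fun l hl => ?_) ih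
    obtain ⟨h1, ⟨K, hK, h2⟩, h3⟩ := hl
    refine supported_mono ?_ (subdiv_single_mem_on hn (by positivity) h1 h3)
    rintro l' ⟨h1', h2', h3'⟩
    refine ⟨h1', ⟨K, hK, fun x hx => convexHull_min h2 (h𝒦 K hK) (h2' x hx)⟩, ?_⟩
    rw [pow_succ', mul_assoc]
    exact h3'

lemma boundary_subdiv_iterate (b : List X → X) (n k : ℕ) (c : Chain X) :
    boundary ((subdiv b (n + 1))^[k] c) = (subdiv b n)^[k] (boundary c) := by
  exact (Function.Semiconj.iterate_right (fun c => boundary_subdiv b n c) k) c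

end Metric

section Label

/-- The labels `±1, ±2, ±3`: a sign and an index. -/
abbrev Label := Bool × Fin 3

/-- The opposite label. -/
def Label.neg (a : Label) : Label := (!a.1, a.2)

/-- The indicator of lists of `n` labels which, sorted by index, have distinct indices and alternating
signs starting with a positive one. -/
def alt : ℕ → List Label → ZMod 2
  | 0, _ => 1
  | 1, l => if (true, 0) ∈ l ∨ (true, 1) ∈ l ∨ (true, 2) ∈ l then 1 else 0
  | 2, l => if ((true, 0) ∈ l ∧ (false, 1) ∈ l) ∨ ((true, 0) ∈ l ∧ (false, 2) ∈ l) ∨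
      ((true, 1) ∈ l ∧ (false, 2) ∈ l) then 1 else 0
  | 3, l => if (true, 0) ∈ l ∧ (false, 1) ∈ l ∧ (true, 2) ∈ l then 1 else 0
  | _, _ => 0

lemma alt_faces_one (a : Label) : alt 0 [] = alt 1 [a] + alt 1 [a.neg] := by
  revert a; decide

lemma alt_faces_two : ∀ (a b : Label), b ≠ a.neg →
    alt 1 [b] + alt 1 [a] = alt 2 [a, b] + alt 2 [a.neg, b.neg] := by
  decide

lemma alt_faces_three : ∀ (a b c : Label), b ≠ a.neg → c ≠ a.neg → c ≠ b.neg →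
    alt 2 [b, c] + (alt 2 [a, c] + alt 2 [a, b]) =
      alt 3 [a, b, c] + alt 3 [a.neg, b.neg, c.neg] := by
  decide

set_option maxRecDepth 10000 in
lemma alt_faces_four : ∀ a b : Label, b ≠ a.neg → ∀ c : Label, c ≠ a.neg ∧ c ≠ b.neg →
    ∀ d : Label, d ≠ a.neg ∧ d ≠ b.neg ∧ d ≠ c.neg →
    alt 3 [b, c, d] + (alt 3 [a, c, d] + (alt 3 [a, b, d] + alt 3 [a, b, c])) = 0 := by
  decide

/-- The linear extension of `alt`. -/
def altL (n : ℕ) : Chain Label →ₗ[ZMod 2] ZMod 2 := linearCombination (ZMod 2) (alt n)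

lemma altL_single (n : ℕ) (l : List Label) : altL n (single l 1) = alt n l := by
  simp [altL]

lemma altL_faces {n : ℕ} (hn : n ≤ 3) {l : List Label} (hl : l.length = n + 1)
    (h : ∀ a ∈ l, ∀ b ∈ l, b ≠ a.neg) :
    altL n (faces l) = alt (n + 1) l + alt (n + 1) (l.map Label.neg) := by
  have hne {a b : Label} (ha : a ∈ l) (hb : b ∈ l) : b ≠ a.neg := h a ha b hb
  interval_cases n
  · obtain ⟨a, rfl⟩ := List.length_eq_one_iff.1 hl
    simpa [faces_cons, altL_single] using alt_faces_one a
  · obtain ⟨a, b, rfl⟩ := List.length_eq_two.1 hl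
    simpa [faces_cons, altL_single] using
      alt_faces_two a b (hne (by simp) (by simp))
  · obtain ⟨a, b, c, rfl⟩ := List.length_eq_three.1 hl
    simpa [faces_cons, altL_single] using
      alt_faces_three a b c (hne (by simp) (by simp)) (hne (by simp) (by simp))
        (hne (by simp) (by simp))
  · obtain ⟨a, b, c, d, rfl⟩ : ∃ a b c d, l = [a, b, c, d] := by
      match l, hl with
      | [a, b, c, d], _ => exact ⟨a, b, c, d, rfl⟩
    simpa [faces_cons, altL_single, alt] using
      alt_faces_four a b (hne (by simp) (by simp)) c
        ⟨hne (by simp) (by simp), hne (by simp) (by simp)⟩ d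
        ⟨hne (by simp) (by simp), hne (by simp) (by simp), hne (by simp) (by simp)⟩

end Label
section Sphere

variable {E : Type*} [AddCommGroup E]

/-- The hemispheres of increasing dimension of the cross-polytope spanned by `e 0, e 1, …`. -/
def hemi (e : ℕ → E) : ℕ → Chain E
  | 0 => single [] 1
  | 1 => single [e 0] 1
  | n + 2 => cone (e (n + 1)) (hemi e (n + 1) + push Neg.neg (hemi e (n + 1)))

lemma push_neg_push_neg (c : Chain E) : push Neg.neg (push Neg.neg c) = c := by
  have : push Neg.neg ∘ₗ push Neg.neg = (LinearMap.id : Chain E →ₗ[ZMod 2] Chain E) := by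
    ext l : 2
    simp
  exact LinearMap.congr_fun this c

lemma boundary_hemi_one (e : ℕ → E) : boundary (hemi e 1) = hemi e 0 := by
  simp [hemi, faces_cons]

lemma boundary_hemi (e : ℕ → E) (n : ℕ) :
    boundary (hemi e (n + 2)) = hemi e (n + 1) + push Neg.neg (hemi e (n + 1)) := by
  have key : boundary (hemi e (n + 1) + push Neg.neg (hemi e (n + 1))) = 0 := by
    rw [map_add, boundary_push]
    cases n with
    | zero => rw [boundary_hemi_one, hemi, push_single, List.map_nil, chain_add_self]
    | succ n =>
      rw [boundary_hemi e n, map_add, push_neg_push_neg, add_comm (push Neg.neg _), chain_add_self]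
  rw [hemi, boundary_cone, key]
  simp

/-- All values of `s` are `±1`. -/
def IsSign (s : ℕ → ℝ) : Prop := ∀ i, s i = 1 ∨ s i = -1

lemma hemi_mem_on [Module ℝ E] (e : ℕ → E) (n : ℕ) :
    hemi e n ∈ On {l | l.length = n ∧ ∃ s, IsSign s ∧ ∀ x ∈ l, ∃ i < n, x = s i • e i} := by
  induction n with
  | zero => exact single_mem_on ⟨rfl, 1, fun i => Or.inl rfl, by simp⟩
  | succ n ih =>
    cases n with
    | zero => exact single_mem_on ⟨rfl, 1, fun i => Or.inl rfl, by simp⟩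
    | succ n =>
      have hneg := push_mem_on (g := Neg.neg) (t := {l | l.length = n + 1 ∧ ∃ s, IsSign s ∧
          ∀ x ∈ l, ∃ i < n + 1, x = s i • e i}) (by
        rintro l ⟨h1, s, hs, h2⟩
        refine ⟨by simp [h1], -s, fun i => ?_, ?_⟩
        · rcases hs i with h | h <;> simp [h]
        · intro x hx
          obtain ⟨y, hy, rfl⟩ := List.mem_map.1 hx
          obtain ⟨i, hi, rfl⟩ := h2 y hy
          exact ⟨i, hi, by simp⟩) ih
      refine cone_mem_on ?_ (add_mem ih hneg)
      rintro l ⟨h1, s, hs, h2⟩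
      refine ⟨by simp [h1], Function.update s (n + 1) 1, fun i => ?_, ?_⟩
      · by_cases hi : i = n + 1
        · simp [hi]
        · simpa [hi] using hs i
      · intro x hx
        rcases List.mem_cons.1 hx with rfl | hx
        · exact ⟨n + 1, by simp, by simp⟩
        · obtain ⟨i, hi, rfl⟩ := h2 x hx
          exact ⟨i, by omega, by simp [hi.ne]⟩

/-- The part of the unit cube beyond the facet of the cross-polytope with signs `s`. -/
def signCap (s : ℕ → ℝ) : Set (Fin 4 → ℝ) := {x | ‖x‖ ≤ 1 ∧ 1 ≤ ∑ j : Fin 4, s j * x j}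

lemma convex_signCap (s : ℕ → ℝ) : Convex ℝ (signCap s) := by
  have h1 : Convex ℝ {x : Fin 4 → ℝ | ‖x‖ ≤ 1} := by
    simpa [Metric.closedBall, dist_zero_right] using convex_closedBall (0 : Fin 4 → ℝ) 1
  have h2 : Convex ℝ {x : Fin 4 → ℝ | 1 ≤ ∑ j : Fin 4, s j * x j} :=
    convex_halfSpace_ge (f := fun x : Fin 4 → ℝ => ∑ j : Fin 4, s j * x j)
      ⟨fun x y => by simp [mul_add, Finset.sum_add_distrib],
        fun c x => by simp [Finset.mul_sum, mul_left_comm]⟩ 1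
  exact h1.inter h2

/-- All the sets `signCap s`. -/
def signCaps : Set (Set (Fin 4 → ℝ)) := {K | ∃ s, IsSign s ∧ K = signCap s}

/-- The unit cube without the interior of the cross-polytope. -/
def octShell : Set (Fin 4 → ℝ) := {x | ‖x‖ ≤ 1 ∧ 1 ≤ ∑ j, |x j|}

lemma signCap_subset_octShell {s : ℕ → ℝ} (hs : IsSign s) : signCap s ⊆ octShell := by
  rintro x ⟨h1, h2⟩
  refine ⟨h1, h2.trans (Finset.sum_le_sum fun j _ => ?_)⟩
  rcases hs j with h | h <;> simp [h, le_abs_self, neg_le_abs]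

lemma isCompact_octShell : IsCompact octShell := by
  have h : IsClosed {x : Fin 4 → ℝ | 1 ≤ ∑ j, |x j|} :=
    isClosed_le continuous_const (by fun_prop)
  have := (isCompact_closedBall (0 : Fin 4 → ℝ) 1).inter_right h
  simpa [octShell, Metric.closedBall, Set.ofPred_and] using this

/-- The standard basis vectors. -/
def stdVec (i : ℕ) : Fin 4 → ℝ := fun j => if (j : ℕ) = i then 1 else 0

lemma smul_stdVec_mem_signCap {s : ℕ → ℝ} (hs : IsSign s) {i : ℕ} (hi : i < 4) :
    s i • stdVec i ∈ signCap s := by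
  constructor
  · refine (pi_norm_le_iff_of_nonneg zero_le_one).2 fun j => ?_
    rcases hs i with h | h <;> by_cases hj : (j : ℕ) = i <;> simp [h, stdVec, hj]
  · have hterm : ∀ j : Fin 4, s j * (s i • stdVec i) j
        = if j = (⟨i, hi⟩ : Fin 4) then 1 else 0 := by
      intro j
      by_cases hj : (j : ℕ) = i
      · rcases hs i with h | h <;> simp [h, stdVec, hj, Fin.ext_iff]
      · simp [stdVec, hj, Fin.ext_iff]
    rw [Finset.sum_congr rfl fun j _ => hterm j]
    simp

lemma hemi_stdVec_mem_on {n : ℕ} (hn : n ≤ 4) : hemi stdVec n ∈ On (Fine signCaps n 2) := by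
  refine supported_mono ?_ (hemi_mem_on stdVec n)
  rintro l ⟨h1, s, hs, h2⟩
  have h3 : ∀ x ∈ l, x ∈ signCap s := by
    intro x hx
    obtain ⟨i, hi, rfl⟩ := h2 x hx
    exact smul_stdVec_mem_signCap hs (hi.trans_le hn)
  refine ⟨h1, ⟨_, ⟨s, hs, rfl⟩, h3⟩, fun x hx y hy => ?_⟩
  have := (h3 x hx).1
  have := (h3 y hy).1
  exact (dist_le_norm_add_norm x y).trans (by linarith)

/-- Arbitrarily fine chains representing the hemispheres of dimension at most three. -/
lemma exists_fine_hemispheres {δ : ℝ} (hδ : 0 < δ) : ∃ c : ℕ → Chain (Fin 4 → ℝ),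
    boundary (c 1) = single [] 1 ∧
    (∀ n, boundary (c (n + 2)) = c (n + 1) + push Neg.neg (c (n + 1))) ∧
    ∀ n ≤ 4, c n ∈ On (Fine signCaps n δ) := by
  obtain ⟨k, hk⟩ : ∃ k : ℕ, (3 / 4 : ℝ) ^ k < δ / 2 :=
    exists_pow_lt_of_lt_one (by positivity) (by norm_num)
  have hpush (n : ℕ) (c : Chain (Fin 4 → ℝ)) :
      push Neg.neg ((subdiv bary n)^[k] c) = (subdiv bary n)^[k] (push Neg.neg c) :=
    (Function.Semiconj.iterate_right (f := push Neg.neg)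
      (fun c => push_subdiv bary Neg.neg bary_map_neg n c) k) c
  refine ⟨fun n => (subdiv bary n)^[k] (hemi stdVec n), ?_, fun n => ?_, fun n hn => ?_⟩
  · rw [boundary_subdiv_iterate, boundary_hemi_one]
    exact congrFun (Function.iterate_id k) _
  · simp only [boundary_subdiv_iterate, boundary_hemi, hpush]
    exact iterate_map_add _ _ _ _
  · refine supported_mono ?_ (subdiv_iterate_mem_on (N := 4) ?_ hn (by norm_num) zero_le_two
      (hemi_stdVec_mem_on hn) k)
    · rintro l ⟨h1, h2, h3⟩
      refine ⟨h1, h2, fun x hx y hy => (h3 x hx y hy).trans ?_⟩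
      norm_num at hk ⊢
      linarith
    · rintro _ ⟨s, -, rfl⟩
      exact convex_signCap s

/-- The first index at which `y` has absolute value at least `ε`, with the sign of that entry. -/
def labelOf (ε : ℝ) (y : Fin 3 → ℝ) : Label :=
  if ε ≤ |y 0| then (decide (0 < y 0), 0) else
  if ε ≤ |y 1| then (decide (0 < y 1), 1) else (decide (0 < y 2), 2)

lemma labelOf_spec {ε : ℝ} {y : Fin 3 → ℝ} (h : ∃ i, ε ≤ |y i|) :
    ε ≤ |y (labelOf ε y).2| ∧ (labelOf ε y).1 = decide (0 < y (labelOf ε y).2) := by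
  unfold labelOf
  split_ifs with h0 h1
  · exact ⟨h0, rfl⟩
  · exact ⟨h1, rfl⟩
  · obtain ⟨i, hi⟩ := h
    fin_cases i
    · exact absurd hi h0
    · exact absurd hi h1
    · exact ⟨hi, rfl⟩

lemma labelOf_neg {ε : ℝ} (hε : 0 < ε) {y : Fin 3 → ℝ} (h : ∃ i, ε ≤ |y i|) :
    labelOf ε (-y) = (labelOf ε y).neg := by
  have hs : ∀ t : ℝ, ε ≤ |t| → decide (0 < -t) = !decide (0 < t) := by
    intro t ht
    have : t ≠ 0 := by rintro rfl; simp at ht; linarith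
    rcases lt_or_gt_of_ne this with h | h
    · simp [h, h.le]
    · simp [h, h.le]
  have hspec := labelOf_spec h
  unfold labelOf at hspec ⊢
  simp only [Pi.neg_apply, abs_neg]
  split_ifs at hspec ⊢ <;> exact Prod.ext (hs _ hspec.1) rfl

lemma labelOf_ne_neg {ε : ℝ} {y z : Fin 3 → ℝ} (hy : ∃ i, ε ≤ |y i|)
    (hz : ∃ i, ε ≤ |z i|) (hyz : dist y z < ε) : labelOf ε z ≠ (labelOf ε y).neg := by
  intro h
  obtain ⟨hy1, hy2⟩ := labelOf_spec hy
  obtain ⟨hz1, hz2⟩ := labelOf_spec hz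
  have hi : (labelOf ε z).2 = (labelOf ε y).2 := by rw [h]; rfl
  have hsgn : (labelOf ε z).1 = !(labelOf ε y).1 := by rw [h]; rfl
  rw [hz2, hy2, hi] at hsgn
  rw [hi] at hz1
  generalize (labelOf ε y).2 = i at *
  have hd := (dist_le_pi_dist y z i).trans_lt hyz
  rw [Real.dist_eq, abs_lt] at hd
  by_cases h0 : 0 < y i
  · simp [h0] at hsgn
    rw [abs_of_pos h0] at hy1
    linarith
  · simp [h0] at hsgn
    rw [abs_of_pos hsgn] at hz1
    linarith [not_lt.1 h0]

end Sphere

/-- **Borsuk–Ulam theorem** for the three-dimensional sphere. -/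
theorem exists_ne_zero_eq_zero_of_odd {f : (Fin 4 → ℝ) → (Fin 3 → ℝ)} (hf : Continuous f)
    (hodd : ∀ x, f (-x) = -f x) : ∃ x, x ≠ 0 ∧ f x = 0 := by
  by_contra! hne
  obtain ⟨ε, hε, hbig⟩ : ∃ ε > 0, ∀ x ∈ octShell, ε ≤ ‖f x‖ := by
    refine isCompact_octShell.exists_forall_le' (f := fun x => ‖f x‖) (by fun_prop) (a := 0) ?_
    rintro x ⟨-, hx⟩
    refine norm_pos_iff.2 (hne x ?_)
    rintro rfl
    norm_num at hx
  have hex : ∀ x ∈ octShell, ∃ i, ε ≤ |f x i| := by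
    intro x hx
    by_contra! h
    exact (hbig x hx).not_gt ((pi_norm_lt_iff hε).2 h)
  obtain ⟨δ, hδ, hunif⟩ := Metric.uniformContinuousOn_iff.1
    (isCompact_octShell.uniformContinuousOn_of_continuous hf.continuousOn) ε hε
  obtain ⟨c, hc1, hc, hfine⟩ := exists_fine_hemispheres (half_pos hδ)
  set lab : (Fin 4 → ℝ) → Label := fun x => labelOf ε (f x) with hlab
  have key (n : ℕ) (hn : n ≤ 3) : altL n (push lab (boundary (c (n + 1)))) =
      altL (n + 1) (push lab (c (n + 1) + push Neg.neg (c (n + 1)))) := by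
    suffices h : ∀ l ∈ Fine signCaps (n + 1) (δ / 2),
        (altL n ∘ₗ push lab ∘ₗ boundary) (single l 1) =
          (altL (n + 1) ∘ₗ push lab ∘ₗ (LinearMap.id + push Neg.neg)) (single l 1) from
      eq_of_single h (hfine (n + 1) (by omega))
    rintro l ⟨h1, ⟨_, ⟨s, hs, rfl⟩, h2⟩, h3⟩
    have h4 : ∀ x ∈ l, x ∈ octShell := fun x hx => signCap_subset_octShell hs (h2 x hx)
    have h5 : (l.map Neg.neg).map lab = (l.map lab).map Label.neg := by
      simp only [List.map_map]
      refine List.map_congr_left fun x hx => ?_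
      simp [hlab, hodd, labelOf_neg hε (hex x (h4 x hx))]
    have h6 := altL_faces hn (l := l.map lab) (by simp [h1]) (by
      simp only [List.mem_map]
      rintro _ ⟨x, hx, rfl⟩ _ ⟨y, hy, rfl⟩
      exact labelOf_ne_neg (hex x (h4 x hx)) (hex y (h4 y hy))
        (hunif x (h4 x hx) y (h4 y hy) ((h3 x hx y hy).trans_lt (half_lt_self hδ))))
    simpa [push_faces, altL_single, h5] using h6
  have h0 := key 0 (by norm_num)
  rw [hc1, ← hc 0, key 1 (by norm_num), ← hc 1, key 2 (by norm_num), ← hc 2, key 3 le_rfl] at h0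
  have h4 : altL 4 = 0 := by ext l; simp [altL, alt]
  rw [h4, push_single, altL_single] at h0
  simp [alt] at h0

end ListChain

end

noncomputable section
namespace UniversalCover

section Support

variable {E : Type*} [NormedAddCommGroup E] [InnerProductSpace ℝ E]

/-- The support function of `C`. -/
def supp (C : Set E) (v : E) : ℝ := sSup ((fun x => ⟪x, v⟫) '' C)

lemma continuous_supp {C : Set E} (hC : IsCompact C) : Continuous (supp C) :=
  hC.continuous_sSup (f := fun v x => ⟪x, v⟫) (by fun_prop)

lemma supp_smul (C : Set E) {t : ℝ} (ht : 0 ≤ t) (v : E) : supp C (t • v) = t * supp C v := by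
  open scoped Pointwise in
  have : (fun x => ⟪x, t • v⟫) '' C = t • ((fun x => ⟪x, v⟫) '' C) := by
    rw [← Set.image_smul, Set.image_image]
    simp [inner_smul_right]
  rw [supp, this, Real.sSup_smul_of_nonneg ht, smul_eq_mul, supp]

lemma inner_le_supp {C : Set E} (hC : IsCompact C) {z : E} (hz : z ∈ C) (v : E) :
    ⟪z, v⟫ ≤ supp C v :=
  le_csSup (hC.image (by fun_prop)).bddAbove ⟨z, hz, rfl⟩

lemma supp_neg (C : Set E) (v : E) : supp C (-v) = -sInf ((fun x => ⟪x, v⟫) '' C) := by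
  have : (fun x => ⟪x, -v⟫) '' C = -((fun x => ⟪x, v⟫) '' C) := by
    rw [← Set.image_neg_eq_neg, Set.image_image]
    simp
  rw [supp, this, Real.sInf_def, neg_neg]

/-- The odd part of the support function of `C`. -/
def oddSupp (C : Set E) (v : E) : ℝ := (supp C v - supp C (-v)) / 2

lemma continuous_oddSupp {C : Set E} (hC : IsCompact C) : Continuous (oddSupp C) := by
  have := continuous_supp hC
  unfold oddSupp
  fun_prop

lemma oddSupp_neg (C : Set E) (v : E) : oddSupp C (-v) = -oddSupp C v := by
  simp only [oddSupp, neg_neg]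
  ring

lemma oddSupp_smul (C : Set E) {t : ℝ} (ht : 0 ≤ t) (v : E) :
    oddSupp C (t • v) = t * oddSupp C v := by
  rw [oddSupp, ← smul_neg, supp_smul C ht, supp_smul C ht, oddSupp]
  ring

lemma supp_eq_oddSupp_add {C : Set E} {v : E}
    (h : sSup ((fun x => ⟪x, v⟫) '' C) - sInf ((fun x => ⟪x, v⟫) '' C) = 1) :
    supp C v = oddSupp C v + 1 / 2 := by
  have h' : supp C v + supp C (-v) = 1 := by rw [supp_neg, supp, ← h]; ring
  rw [oddSupp]
  linarith

end Support

section Quaternion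

open Matrix

/-- The matrix of left multiplication by the quaternion with coordinates `q`. -/
def leftMul (q : Fin 4 → ℝ) : Matrix (Fin 4) (Fin 4) ℝ :=
  !![q 0, -q 1, -q 2, -q 3;
     q 1, q 0, -q 3, q 2;
     q 2, q 3, q 0, -q 1;
     q 3, -q 2, q 1, q 0]

lemma leftMul_smul (t : ℝ) (q : Fin 4 → ℝ) : leftMul (t • q) = t • leftMul q := by
  ext i j
  fin_cases i <;> fin_cases j <;> simp [leftMul]

lemma leftMul_neg (q : Fin 4 → ℝ) : leftMul (-q) = -leftMul q := by
  simpa using leftMul_smul (-1) q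

lemma continuous_leftMul : Continuous leftMul := by
  refine continuous_matrix fun i j => ?_
  fin_cases i <;> fin_cases j <;> simp [leftMul] <;> fun_prop

lemma leftMul_mem_specialOrthogonalGroup {q : Fin 4 → ℝ} (hq : ∑ i, q i ^ 2 = 1) :
    leftMul q ∈ specialOrthogonalGroup (Fin 4) ℝ := by
  simp only [Fin.sum_univ_four] at hq
  refine mem_specialOrthogonalGroup_iff.2 ⟨(mem_orthogonalGroup_iff _ _).2 ?_, ?_⟩
  · ext i j
    fin_cases i <;> fin_cases j <;>
      simp [leftMul, mul_apply, Fin.sum_univ_four] <;> linarith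
  · have : (leftMul q).det = (q 0 ^ 2 + q 1 ^ 2 + q 2 ^ 2 + q 3 ^ 2) ^ 2 := by
      simp [leftMul, det_succ_row_zero, Fin.sum_univ_succ, Fin.succAbove]
      ring
    rw [this, hq, one_pow]

end Quaternion

section Cover

open Matrix

/-- The Euclidean space `ℝ⁴`. -/
abbrev E4 := EuclideanSpace ℝ (Fin 4)

/-- Action of a matrix on Euclidean vectors. -/
def act (M : Matrix (Fin 4) (Fin 4) ℝ) (v : E4) : E4 := WithLp.toLp 2 (M *ᵥ v.ofLp)

lemma inner_act (M : Matrix (Fin 4) (Fin 4) ℝ) (v w : E4) : ⟪act M v, w⟫ = ⟪v, act Mᵀ w⟫ := by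
  simp [act, EuclideanSpace.inner_eq_star_dotProduct, dotProduct_mulVec, dotProduct_comm,
    mulVec_transpose]

lemma act_act (M N : Matrix (Fin 4) (Fin 4) ℝ) (v : E4) : act M (act N v) = act (M * N) v := by
  simp [act]

lemma act_one (v : E4) : act 1 v = v := by simp [act]

lemma act_smul (M : Matrix (Fin 4) (Fin 4) ℝ) (t : ℝ) (v : E4) :
    act (t • M) v = t • act M v := by
  simp [act, smul_mulVec]

lemma act_neg (M : Matrix (Fin 4) (Fin 4) ℝ) (v : E4) : act M (-v) = -act M v := by
  simp [act, mulVec_neg]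

variable {m : ℕ} {u : Fin m → E4}

lemma exists_eq_neg (hu1 : ∀ i, ‖u i‖ = 1)
    (hsymm : {x : E4 | ∀ i, ⟪x, u i⟫ ≤ 1 / 2} = -{x : E4 | ∀ i, ⟪x, u i⟫ ≤ 1 / 2}) (i : Fin m) :
    ∃ j, u j = -u i := by
  by_contra! hne
  have hlt : ∀ j, ⟪-u i, u j⟫ < 1 := fun j =>
    inner_lt_one_iff_real_of_norm_eq_one (by simp [hu1]) (hu1 j) |>.2 (hne j).symm
  have : Nonempty (Fin m) := ⟨i⟩
  obtain ⟨k, hk⟩ := Finite.exists_max fun j => ⟪-u i, u j⟫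
  set a := ⟪-u i, u k⟫ with ha
  obtain ⟨t, ht1, ht⟩ : ∃ t : ℝ, 1 < t ∧ t * a ≤ 1 := by
    rcases le_or_gt a 0 with h | h
    · exact ⟨2, by norm_num, by linarith⟩
    · exact ⟨a⁻¹, (one_lt_inv₀ h).2 (hlt k), by rw [inv_mul_cancel₀ h.ne']⟩
  have hmem : -((t / 2) • u i) ∈ {x : E4 | ∀ j, ⟪x, u j⟫ ≤ 1 / 2} := by
    intro j
    have := mul_le_mul_of_nonneg_left (hk j) (by linarith : 0 ≤ t)
    rw [← smul_neg, real_inner_smul_left]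
    linarith
  rw [hsymm, Set.neg_mem_neg] at hmem
  have := hmem i
  rw [real_inner_smul_left, real_inner_self_eq_norm_sq, hu1] at this
  linarith

/-- A symmetric family of at most 14 unit vectors consists of at most seven antipodal pairs. -/
lemma exists_half (hm : m ≤ 14) (hu1 : ∀ i, ‖u i‖ = 1) (huinj : Function.Injective u)
    (hneg : ∀ i, ∃ j, u j = -u i) :
    ∃ T : Finset (Fin m), T.card ≤ 7 ∧ ∀ i, i ∈ T ∨ ∃ j ∈ T, u i = -u j := by
  obtain ⟨φ, hφ⟩ := Module.exists_dual_forall_apply_ne_zero (K := ℝ) u fun i hi => by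
    simpa [hi] using hu1 i
  choose σ hσ using hneg
  have hσinj : Function.Injective σ := fun i j h => huinj (by
    rw [← neg_inj, ← hσ, ← hσ, h])
  refine ⟨Finset.univ.filter fun i => 0 < φ (u i), ?_, fun i => ?_⟩
  · have h1 := Finset.card_filter_add_card_filter_not (s := Finset.univ) fun i => 0 < φ (u i)
    have h2 : (Finset.univ.filter fun i => 0 < φ (u i)).card ≤
        (Finset.univ.filter fun i => ¬ 0 < φ (u i)).card := by
      refine Finset.card_le_card_of_injOn σ (fun i hi => ?_) hσinj.injOn
      simp only [Finset.coe_filter, Finset.mem_univ, true_and, Set.mem_ofPred_eq] at hi ⊢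
      simp [hσ, hi.le]
    simp only [Finset.card_univ, Fintype.card_fin] at h1
    omega
  · rcases lt_or_gt_of_ne (hφ i) with h | h
    · exact Or.inr ⟨σ i, by simp [hσ, h], by simp [hσ]⟩
    · exact Or.inl (by simp [h])

lemma eq_zero_of_forall_inner_eq_zero (hbd : IsCompact {x : E4 | ∀ i, ⟪x, u i⟫ ≤ 1 / 2}) {x : E4}
    (hx : ∀ i, ⟪x, u i⟫ = 0) : x = 0 := by
  obtain ⟨R, hR⟩ := hbd.isBounded.exists_norm_le
  by_contra hne
  have hpos := norm_pos_iff.2 hne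
  have := hR (((|R| + 1) / ‖x‖) • x) fun i => by
    rw [real_inner_smul_left, hx i]; norm_num
  rw [norm_smul, Real.norm_of_nonneg (by positivity), div_mul_cancel₀ _ hpos.ne'] at this
  linarith [le_abs_self R]

/-- At most seven vectors spanning `ℝ⁴` satisfy at most three independent linear relations. -/
lemma exists_linearMap_ker {T : Finset (Fin m)} (hT : T.card ≤ 7)
    (hinj : ∀ x : E4, (∀ i ∈ T, ⟪x, u i⟫ = 0) → x = 0) :
    ∃ B : (T → ℝ) →ₗ[ℝ] (Fin 3 → ℝ), ∀ w, B w = 0 → ∃ x : E4, ∀ i : T, w i = ⟪x, u i⟫ := by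
  let A : E4 →ₗ[ℝ] (T → ℝ) := LinearMap.pi fun i => (innerₗ E4).flip (u i)
  have hA : Function.Injective A := by
    refine (injective_iff_map_eq_zero A).2 fun x hx => hinj x fun i hi => ?_
    simpa [A, real_inner_comm] using congrFun hx ⟨i, hi⟩
  have hrange : Module.finrank ℝ (LinearMap.range A) = 4 := by
    rw [LinearMap.finrank_range_of_inj hA]; simp
  have hquot := Submodule.finrank_quotient_add_finrank (LinearMap.range A)
  rw [hrange, Module.finrank_fintype_fun_eq_card, Fintype.card_coe] at hquot
  obtain ⟨B, hB⟩ := (finrank_le_iff_exists_linearMap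
    (R := ℝ) (M := (T → ℝ) ⧸ LinearMap.range A) (M' := Fin 3 → ℝ)).1 (by simp; omega)
  refine ⟨B ∘ₗ (LinearMap.range A).mkQ, fun w hw => ?_⟩
  have h0 : (LinearMap.range A).mkQ w = 0 := hB (by simpa using hw)
  obtain ⟨x, rfl⟩ := (Submodule.Quotient.mk_eq_zero _).1 h0
  exact ⟨x, fun i => by simp [A, real_inner_comm]⟩

/-- Some rotation makes the odd part of the support function of `C` agree with a linear functional
on the rotated copies of at most seven spanning directions. -/
lemma exists_rotation {T : Finset (Fin m)} (hT : T.card ≤ 7)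
    (hinj : ∀ x : E4, (∀ i ∈ T, ⟪x, u i⟫ = 0) → x = 0) {C : Set E4} (hC : IsCompact C) :
    ∃ τ ∈ specialOrthogonalGroup (Fin 4) ℝ, ∃ x : E4, ∀ i ∈ T,
      oddSupp C (act τ (u i)) = ⟪x, act τ (u i)⟫ := by
  obtain ⟨B, hB⟩ := exists_linearMap_ker hT hinj
  obtain ⟨q, hq0, hq⟩ := ListChain.exists_ne_zero_eq_zero_of_odd
    (f := fun q => B fun i => oddSupp C (act (leftMul q) (u i))) (by
      have h1 := continuous_oddSupp hC
      have h2 := continuous_leftMul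
      have h3 := B.continuous_of_finiteDimensional
      refine h3.comp (continuous_pi fun i => h1.comp ?_)
      exact (PiLp.continuous_toLp 2 _).comp (h2.matrix_mulVec continuous_const)) (by
      intro q
      rw [← map_neg]
      congr 1
      ext i
      rw [Pi.neg_apply, ← oddSupp_neg, leftMul_neg]
      congr 1
      simpa using act_smul (leftMul q) (-1) (u i))
  obtain ⟨x, hx⟩ := hB _ hq
  have hpos : 0 < ∑ i, q i ^ 2 := by
    obtain ⟨i, hi⟩ := Function.ne_iff.1 hq0
    exact Finset.sum_pos' (fun i _ => sq_nonneg _) ⟨i, Finset.mem_univ i, by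
      have : q i ≠ 0 := hi
      positivity⟩
  set t := (√(∑ i, q i ^ 2))⁻¹ with ht
  have htpos : 0 < t := inv_pos.2 (Real.sqrt_pos.2 hpos)
  have hτ : leftMul (t • q) ∈ specialOrthogonalGroup (Fin 4) ℝ := by
    refine leftMul_mem_specialOrthogonalGroup ?_
    simp only [Pi.smul_apply, smul_eq_mul, mul_pow, ← Finset.mul_sum]
    rw [ht, inv_pow, Real.sq_sqrt hpos.le, inv_mul_cancel₀ hpos.ne']
  have hort : (leftMul (t • q))ᵀ * leftMul (t • q) = 1 :=
    (mem_orthogonalGroup_iff' _ _).1 (mem_specialOrthogonalGroup_iff.1 hτ).1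
  refine ⟨leftMul (t • q), hτ, act (leftMul (t • q)) (t • x), fun i hi => ?_⟩
  rw [inner_act, act_act, hort, act_one, leftMul_smul, act_smul, oddSupp_smul C htpos.le,
    real_inner_smul_left, hx ⟨i, hi⟩]

end Cover

end UniversalCover

end

open UniversalCover in
/-- Main theorem: every centrally symmetric convex polytope `P ⊂ ℝ⁴` with at
most 14 facets, circumscribed about the Euclidean ball of diameter 1 (each of
its facet-hyperplanes being tangent to the ball, i.e. of the form
`⟪x, uᵢ⟫ = 1/2` with `uᵢ` a unit normal), is a universal cover: every convex
body `C` of constant width 1 is covered by a rotated translate of `P`. -/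
theorem centrally_symmetric_polytope_at_most_14_facets_universal_cover
    (m : ℕ) (hm : m ≤ 14) (u : Fin m → EuclideanSpace ℝ (Fin 4))
    (hu1 : ∀ i, ‖u i‖ = 1) (huinj : Function.Injective u)
    (P : Set (EuclideanSpace ℝ (Fin 4)))
    (hP : P = {x | ∀ i, ⟪x, u i⟫ ≤ 1 / 2})
    (hPbd : IsCompact P)
    -- each of the `m` halfspaces is irredundant, i.e. bounds a facet of `P`
    (hfacet : ∀ i, {x | ∀ j, j ≠ i → ⟪x, u j⟫ ≤ 1 / 2} ≠ P)
    (hsymm : P = -P)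
    (C : Set (EuclideanSpace ℝ (Fin 4)))
    (hCconv : Convex ℝ C) (hCcomp : IsCompact C) (hCint : (interior C).Nonempty)
    (hwidth : ∀ v : EuclideanSpace ℝ (Fin 4), ‖v‖ = 1 →
      sSup ((fun x => ⟪x, v⟫) '' C) - sInf ((fun x => ⟪x, v⟫) '' C) = 1) :
    ∃ τ ∈ Matrix.specialOrthogonalGroup (Fin 4) ℝ,
      ∃ x : EuclideanSpace ℝ (Fin 4),
        ∀ z ∈ C, ∃ p ∈ P, z = x + (WithLp.equiv 2 (Fin 4 → ℝ)).symm (τ.mulVec ((WithLp.equiv 2 (Fin 4 → ℝ)) p)) := by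
  subst hP
  obtain ⟨T, hT, hcov⟩ := exists_half hm hu1 huinj (exists_eq_neg hu1 hsymm)
  obtain ⟨τ, hτ, x, hx⟩ := exists_rotation hT (fun x hx =>
    eq_zero_of_forall_inner_eq_zero hPbd fun i => by
      rcases hcov i with hi | ⟨j, hj, hij⟩
      · exact hx i hi
      · rw [hij, inner_neg_right, hx j hj, neg_zero]) hCcomp
  have hτo := (Matrix.mem_specialOrthogonalGroup_iff.1 hτ).1
  have hmul : τ * τ.transpose = 1 := (Matrix.mem_orthogonalGroup_iff _ _).1 hτo
  have hmul' : τ.transpose * τ = 1 := (Matrix.mem_orthogonalGroup_iff' _ _).1 hτo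
  have hx' : ∀ i, oddSupp C (act τ (u i)) = ⟪x, act τ (u i)⟫ := by
    intro i
    rcases hcov i with hi | ⟨j, hj, hij⟩
    · exact hx i hi
    · rw [hij, act_neg, oddSupp_neg, inner_neg_right, hx j hj]
  have hnorm : ∀ i, ‖act τ (u i)‖ = 1 := by
    intro i
    have h : ‖act τ (u i)‖ ^ 2 = ‖u i‖ ^ 2 := by
      rw [← real_inner_self_eq_norm_sq, inner_act, act_act, hmul', act_one,
        real_inner_self_eq_norm_sq]
    rw [(sq_eq_sq₀ (norm_nonneg _) (norm_nonneg _)).1 h, hu1]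
  refine ⟨τ, hτ, x, fun z hz => ⟨act τ.transpose (z - x), fun i => ?_, ?_⟩⟩
  · rw [inner_act, Matrix.transpose_transpose, inner_sub_left, ← hx' i]
    have := inner_le_supp hCcomp hz (act τ (u i))
    rw [supp_eq_oddSupp_add (hwidth _ (hnorm i))] at this
    linarith
  · have : act τ (act τ.transpose (z - x)) = z - x := by rw [act_act, hmul, act_one]
    exact (add_eq_of_eq_sub' this).symm
end
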